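/- For n ≥ 2 and positive integers k, m, the group ⟨z₁,…,z_{2n} | z_{2i+1} = z_{2i}^{−k} z_{2i+2}^{k}, z_{2i} = z_{2i−1}^{−m} z_{2i+1}^{m} (for i = 1,…,n, subscripts mod 2n), z₂z₄⋯z_{2n} = e⟩ is not left-orderable. -/

import Mathlib

/-- A group is left-orderable if there is a strict total order that is left-invariant. -/
def IsLeftOrderable (G : Type*) [Group G] : Prop :=
  ∃ r : G → G → Prop, IsStrictTotalOrder G r ∧ ∀ x y z : G, r x y → r (z * x) (z * y)

/-- The relators of the `(k,m)`-deformation `F((k,m), 2n)` of the Fibonacci group: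
`z_{2i}^{-k} z_{2i+2}^{k} z_{2i+1}^{-1}` and `z_{2i-1}^{-m} z_{2i+1}^{m} z_{2i}^{-1}`
for `i = 1, …, n` (subscripts mod `2n`), together with `z₂z₄⋯z_{2n}`. -/
def deformedFibRels (n k m : ℕ) : Set (FreeGroup (ZMod (2 * n))) :=
  {w | ∃ i : ℕ, i < n ∧
      w = (((FreeGroup.of ((2 * i : ℕ) : ZMod (2 * n))) ^ k)⁻¹ *
            (FreeGroup.of ((2 * i + 2 : ℕ) : ZMod (2 * n))) ^ k) *
          (FreeGroup.of ((2 * i + 1 : ℕ) : ZMod (2 * n)))⁻¹} ∪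
  {w | ∃ i : ℕ, i < n ∧
      w = (((FreeGroup.of ((2 * i + 1 : ℕ) : ZMod (2 * n))) ^ m)⁻¹ *
            (FreeGroup.of ((2 * i + 3 : ℕ) : ZMod (2 * n))) ^ m) *
          (FreeGroup.of ((2 * i + 2 : ℕ) : ZMod (2 * n)))⁻¹} ∪
  {((List.range n).map (fun j => FreeGroup.of ((2 * j + 2 : ℕ) : ZMod (2 * n)))).prod}

/-! ### Sequences of generators and positive cones -/

section Cone

open scoped Pointwise

variable {G : Type*} [Group G]

/-- A total positive cone of a group: a submonoid containing exactly one of `x`, `x⁻¹` for each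
nontrivial `x`. -/
structure IsTotalCone (P : Submonoid G) : Prop where
  total : ∀ x, x ∈ P ∨ x⁻¹ ∈ P
  antisymm : ∀ x, x ∈ P → x⁻¹ ∈ P → x = 1

theorem IsLeftOrderable.exists_isTotalCone (h : IsLeftOrderable G) :
    ∃ P : Submonoid G, IsTotalCone P := by
  obtain ⟨r, hr, hmul⟩ := h
  refine ⟨{ carrier := {x | x = 1 ∨ r 1 x}, one_mem' := Or.inl rfl, mul_mem' := ?_ }, ?_, ?_⟩
  · rintro x y (rfl | hx) (rfl | hy)
    · simp
    · simpa using Or.inr hy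
    · simpa using Or.inr hx
    · exact Or.inr (_root_.trans hx (by simpa using hmul 1 y x hy))
  · intro x
    rcases trichotomous_of r 1 x with h | h | h
    · exact Or.inl (Or.inr h)
    · exact Or.inl (Or.inl h.symm)
    · exact Or.inr (Or.inr (by simpa using hmul x 1 x⁻¹ h))
  · rintro x (rfl | hx) (h | h)
    · rfl
    · rfl
    · simpa using h
    · have h' : r x 1 := by simpa using hmul 1 x⁻¹ x h
      exact absurd (_root_.trans hx h') (irrefl_of r 1)

variable {P : Submonoid G}

theorem IsTotalCone.inv (hP : IsTotalCone P) : IsTotalCone P⁻¹ where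
  total x := by simpa [or_comm] using hP.total x
  antisymm x h h' := hP.antisymm x (by simpa using h') (by simpa using h)

theorem IsTotalCone.mem_of_pow_mem (hP : IsTotalCone P) {x : G} {p : ℕ} (hp : 0 < p)
    (h : x ^ p ∈ P) : x ∈ P := by
  refine (hP.total x).elim id fun hx => ?_
  have h1 : x ^ p = 1 := hP.antisymm _ h (by simpa using pow_mem hx p)
  obtain ⟨q, rfl⟩ := Nat.exists_eq_succ_of_ne_zero hp.ne'
  have h2 : x = (x⁻¹) ^ q := by
    rw [inv_pow, eq_inv_iff_mul_eq_one, ← pow_succ', h1]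
  rw [h2]
  exact pow_mem hx q

theorem IsTotalCone.eq_one_of_list_prod_eq_one (hP : IsTotalCone P) :
    ∀ l : List G, (∀ x ∈ l, x ∈ P) → l.prod = 1 → ∀ x ∈ l, x = 1
  | [], _, _ => by simp
  | a :: l, hl, h => by
    rw [List.prod_cons] at h
    have hl' : ∀ x ∈ l, x ∈ P := fun x hx => hl x (List.mem_cons_of_mem _ hx)
    have ha : a = 1 := hP.antisymm a (hl a List.mem_cons_self) (by
      rw [← eq_inv_of_mul_eq_one_right h]
      exact P.list_prod_mem hl')
    subst ha
    simpa using hP.eq_one_of_list_prod_eq_one l hl' (by simpa using h)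

/-- The relations satisfied by the generators of `F((k,m), 2n)`, read as a `2n`-periodic sequence
in which the exponent attached to the index `j` is `p j`. -/
structure IsFibSequence (n : ℕ) (p : ℕ → ℕ) (z : ℕ → G) : Prop where
  periodic : Function.Periodic z (2 * n)
  rel : ∀ j, z j ^ p j * z (j + 1) = z (j + 2) ^ p j
  prod_even : ((List.range n).map fun j => z (2 * j + 2)).prod = 1

variable {n : ℕ} {p : ℕ → ℕ} {z : ℕ → G}

theorem IsFibSequence.eq_one_of_even_mem (hz : IsFibSequence n p z) (hP : IsTotalCone P)
    (hn : 0 < n) (h : ∀ j, z (2 * j) ∈ P) (j : ℕ) : z j = 1 := by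
  have hlt : ∀ i < n, z (2 * i + 2) = 1 := fun i hi =>
    hP.eq_one_of_list_prod_eq_one _ (by
      intro x hx
      obtain ⟨j, -, rfl⟩ := List.mem_map.1 hx
      exact h (j + 1)) hz.prod_even _ (List.mem_map.2 ⟨i, List.mem_range.2 hi, rfl⟩)
  have hmod : ∀ i, z (2 * i + 2) = 1 := fun i => by
    rw [← hlt (i % n) (Nat.mod_lt _ hn), ← hz.periodic.nat_mul (i / n) (2 * (i % n) + 2)]
    congr 1
    conv_lhs => rw [← Nat.mod_add_div i n]
    push_cast
    ring
  have heven : ∀ i, z (2 * i) = 1 := fun i => by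
    rw [← hz.periodic (2 * i), show 2 * i + 2 * n = 2 * (i + n - 1) + 2 by omega]
    exact hmod _
  obtain ⟨i, rfl | rfl⟩ := Nat.even_or_odd' j
  · exact heven i
  · have := hz.rel (2 * i)
    rwa [heven, show 2 * i + 2 = 2 * (i + 1) by ring, heven, one_pow, one_mul] at this

theorem IsFibSequence.eq_one_of_consecutive_mem (hz : IsFibSequence n p z) (hP : IsTotalCone P)
    (hn : 0 < n) (hp : ∀ j, 0 < p j) {i : ℕ} (h : z i ∈ P) (h' : z (i + 1) ∈ P) (j : ℕ) :
    z j = 1 := by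
  have hge : ∀ l, z (i + l) ∈ P ∧ z (i + l + 1) ∈ P := by
    intro l
    induction l with
    | zero => exact ⟨h, h'⟩
    | succ l ih =>
      refine ⟨ih.2, hP.mem_of_pow_mem (hp (i + l)) ?_⟩
      rw [show i + (l + 1) + 1 = i + l + 2 by ring, ← hz.rel]
      exact mul_mem (pow_mem ih.1 _) ih.2
  refine hz.eq_one_of_even_mem hP hn (fun l => ?_) j
  have hle : i ≤ 2 * l + i * (2 * n) := by nlinarith
  obtain ⟨d, hd⟩ := Nat.exists_eq_add_of_le hle
  have := hz.periodic.nat_mul i (2 * l)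
  rw [Nat.cast_id, hd] at this
  rw [← this]
  exact (hge d).1

theorem IsFibSequence.eq_one (hz : IsFibSequence n p z) (hP : IsTotalCone P)
    (hn : 0 < n) (hp : ∀ j, 0 < p j) (j : ℕ) : z j = 1 := by
  have aux : ∀ {Q : Submonoid G}, IsTotalCone Q → z 0 ∈ Q → z j = 1 := by
    intro Q hQ h0
    by_contra hne
    have hpos : ∀ i, z i ∈ Q → z (i + 1) ∉ Q := fun i h h' =>
      hne (hz.eq_one_of_consecutive_mem hQ hn hp h h' j)
    have hneg : ∀ i, z i ∉ Q → z (i + 1) ∈ Q := fun i h => by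
      by_contra h'
      have h1 := (hQ.total _).resolve_left h
      have h2 := (hQ.total _).resolve_left h'
      exact hne (hz.eq_one_of_consecutive_mem hQ.inv hn hp (i := i) (by simpa using h1)
        (by simpa using h2) j)
    refine hne (hz.eq_one_of_even_mem hQ hn (fun i => ?_) j)
    induction i with
    | zero => exact h0
    | succ i ih => exact hneg _ (hpos _ ih)
  rcases hP.total (z 0) with h | h
  · exact aux hP h
  · exact aux hP.inv (by simpa using h)

end Cone

/-! ### Nontriviality of the abelianization -/

section Laplacian

variable {n : ℕ}

/-- The operator `1 + N L` on integer functions on the `n`-cycle, `L` being the Laplacian. -/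
def oneAddLaplacian (n : ℕ) (N : ℤ) : (ZMod n → ℤ) →+ (ZMod n → ℤ) where
  toFun v i := v i + N * (2 * v i - v (i + 1) - v (i - 1))
  map_zero' := by ext; simp
  map_add' v w := by ext; simp only [Pi.add_apply]; ring

theorem sum_mul_oneAddLaplacian [NeZero n] (N : ℤ) (v : ZMod n → ℤ) :
    ∑ i, v i * oneAddLaplacian n N v i = ∑ i, v i ^ 2 + N * ∑ i, (v (i + 1) - v i) ^ 2 := by
  have h1 : ∑ i, v (i + 1) ^ 2 = ∑ i, v i ^ 2 :=
    Equiv.sum_comp (Equiv.addRight (1 : ZMod n)) fun i => v i ^ 2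
  have h2 : ∑ i, v (i + 1) * v i = ∑ i, v i * v (i - 1) := by
    simpa using Equiv.sum_comp (Equiv.addRight (1 : ZMod n)) fun i => v i * v (i - 1)
  have h3 : ∑ i, v i * oneAddLaplacian n N v i = ∑ i, v i ^ 2 +
      N * (2 * ∑ i, v i ^ 2 - ∑ i, v (i + 1) * v i - ∑ i, v i * v (i - 1)) := by
    simp only [Finset.mul_sum, ← Finset.sum_add_distrib, ← Finset.sum_sub_distrib]
    refine Finset.sum_congr rfl fun i _ => ?_
    simp only [oneAddLaplacian, AddMonoidHom.coe_mk, ZeroHom.coe_mk]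
    ring
  have h4 : ∑ i, (v (i + 1) - v i) ^ 2 =
      ∑ i, v (i + 1) ^ 2 + ∑ i, v i ^ 2 - 2 * ∑ i, v (i + 1) * v i := by
    simp only [Finset.mul_sum, ← Finset.sum_add_distrib, ← Finset.sum_sub_distrib]
    exact Finset.sum_congr rfl fun i _ => by ring
  rw [h3, h4, h1, ← h2]
  ring

theorem single_zero_notMem_range_oneAddLaplacian (hn : 2 ≤ n) {N : ℤ} (hN : 0 < N) :
    Pi.single 0 1 ∉ (oneAddLaplacian n N).range := by
  rintro ⟨v, hv⟩
  have : Fact (1 < n) := ⟨hn⟩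
  have : NeZero n := ⟨by omega⟩
  have henergy := sum_mul_oneAddLaplacian N v
  rw [hv] at henergy
  simp only [Pi.single_apply, mul_ite, mul_one, mul_zero, Finset.sum_ite_eq', Finset.mem_univ,
    if_true] at henergy
  have h01 : v 0 ^ 2 + v 1 ^ 2 ≤ ∑ i, v i ^ 2 := by
    rw [← Finset.sum_pair (f := fun i => v i ^ 2) (zero_ne_one (α := ZMod n))]
    exact Finset.sum_le_sum_of_subset_of_nonneg (Finset.subset_univ _) fun _ _ _ => sq_nonneg _
  have hdiff : (v 1 - v 0) ^ 2 ≤ ∑ i, (v (i + 1) - v i) ^ 2 := by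
    simpa using Finset.single_le_sum (f := fun i => (v (i + 1) - v i) ^ 2)
      (fun _ _ => sq_nonneg _) (Finset.mem_univ (0 : ZMod n))
  have hmul : ∑ i, (v (i + 1) - v i) ^ 2 ≤ N * ∑ i, (v (i + 1) - v i) ^ 2 :=
    le_mul_of_one_le_left (Finset.sum_nonneg fun _ _ => sq_nonneg _) hN
  have hv0 : v 0 = 0 := by
    have h0 : 0 ≤ v 0 := by nlinarith [sq_nonneg (v 0), sq_nonneg (v 1), sq_nonneg (v 1 - v 0)]
    have h1 : v 0 < 1 := by nlinarith [sq_nonneg (2 * v 1 - v 0)]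
    omega
  have hsum : ∑ i, v i ^ 2 = 0 :=
    le_antisymm (by nlinarith [sq_nonneg (v 1 - v 0)]) (Finset.sum_nonneg fun _ _ => sq_nonneg _)
  have hzero : v = 0 := by
    ext i
    simpa using (Finset.sum_eq_zero_iff_of_nonneg fun _ _ => sq_nonneg _).1 hsum i
      (Finset.mem_univ i)
  subst hzero
  simpa using congrFun hv 0

/-- The cokernel of `1 + km L`, which is the abelianization of `F((k,m), 2n)`. -/
abbrev LaplacianCokernel (n k m : ℕ) : Type :=
  (ZMod n → ℤ) ⧸ (oneAddLaplacian n (k * m)).range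

/-- The class of the indicator function of a vertex. -/
def vertexClass (n k m : ℕ) (i : ZMod n) : LaplacianCokernel n k m :=
  QuotientAddGroup.mk (Pi.single i 1)

theorem vertexClass_zero_ne_zero (hn : 2 ≤ n) {k m : ℕ} (hk : 0 < k) (hm : 0 < m) :
    vertexClass n k m 0 ≠ 0 := by
  rw [vertexClass, Ne, QuotientAddGroup.eq_zero_iff]
  exact single_zero_notMem_range_oneAddLaplacian hn (by positivity)

theorem vertexClass_add_one (k m : ℕ) (i : ZMod n) :
    vertexClass n k m (i + 1) = m • (k • (vertexClass n k m (i + 2) - vertexClass n k m (i + 1)) -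
      k • (vertexClass n k m (i + 1) - vertexClass n k m i)) := by
  simp only [vertexClass, ← QuotientAddGroup.mk_sub, ← QuotientAddGroup.mk_nsmul]
  rw [eq_comm, QuotientAddGroup.eq]
  refine ⟨Pi.single (i + 1) 1, ?_⟩
  ext j
  have e1 : j + 1 = i + 1 ↔ j = i := add_left_inj _
  have e2 : j - 1 = i + 1 ↔ j = i + 2 := by
    rw [sub_eq_iff_eq_add, add_assoc, one_add_one_eq_two]
  simp only [oneAddLaplacian, AddMonoidHom.coe_mk, ZeroHom.coe_mk, Pi.add_apply, Pi.neg_apply,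
    Pi.smul_apply, Pi.sub_apply, Pi.single_apply, e1, e2, smul_eq_mul, ← natCast_zsmul]
  ring

/-- The images of the generators of `F((k,m), 2n)` in the cokernel of `1 + km L`. -/
def generatorClass (n k m : ℕ) (j : ZMod (2 * n)) : LaplacianCokernel n k m :=
  if j.val % 2 = 0 then vertexClass n k m (j.val / 2 : ℕ)
  else k • (vertexClass n k m ((j.val / 2 : ℕ) + 1) - vertexClass n k m (j.val / 2 : ℕ))

theorem generatorClass_even (k m i : ℕ) :
    generatorClass n k m ((2 * i : ℕ) : ZMod (2 * n)) = vertexClass n k m i := by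
  rw [generatorClass, ZMod.val_natCast, Nat.mul_mod_mul_left, if_pos (by omega),
    Nat.mul_div_cancel_left _ two_pos, ZMod.natCast_mod]

theorem generatorClass_odd (k m i : ℕ) :
    generatorClass n k m ((2 * i + 1 : ℕ) : ZMod (2 * n)) =
      k • (vertexClass n k m (i + 1) - vertexClass n k m i) := by
  have h : (2 * i + 1) % (2 * n) = 2 * (i % n) + 1 := by
    rw [Nat.mod_mul, Nat.mul_add_div two_pos]
    simp [Nat.add_comm]
  rw [generatorClass, ZMod.val_natCast, h, if_neg (by omega),
    show (2 * (i % n) + 1) / 2 = i % n by omega, ZMod.natCast_mod]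

theorem lift_generatorClass_eq_one (n k m : ℕ) {w : FreeGroup (ZMod (2 * n))}
    (hw : w ∈ deformedFibRels n k m) :
    FreeGroup.lift (fun j => Multiplicative.ofAdd (generatorClass n k m j)) w = 1 := by
  have hrel : ∀ i : ℕ, generatorClass n k m ((2 * i + 2 : ℕ) : ZMod (2 * n)) =
      m • (generatorClass n k m ((2 * (i + 1) + 1 : ℕ) : ZMod (2 * n)) -
        generatorClass n k m ((2 * i + 1 : ℕ) : ZMod (2 * n))) := by
    intro i
    rw [show 2 * i + 2 = 2 * (i + 1) by ring, generatorClass_even, generatorClass_odd,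
      generatorClass_odd]
    push_cast
    rw [add_assoc, one_add_one_eq_two]
    exact vertexClass_add_one k m _
  rcases hw with (⟨i, -, rfl⟩ | ⟨i, -, rfl⟩) | rfl
  · simp only [map_mul, map_inv, map_pow, FreeGroup.lift_apply_of]
    rw [mul_inv_eq_one, show 2 * i + 2 = 2 * (i + 1) by ring, generatorClass_odd,
      generatorClass_even, generatorClass_even, ← ofAdd_nsmul, ← ofAdd_nsmul, ← ofAdd_neg,
      ← ofAdd_add]
    push_cast
    rw [nsmul_sub, neg_add_eq_sub]
  · simp only [map_mul, map_inv, map_pow, FreeGroup.lift_apply_of]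
    rw [mul_inv_eq_one, hrel, show 2 * i + 3 = 2 * (i + 1) + 1 by ring, ← ofAdd_nsmul,
      ← ofAdd_nsmul, ← ofAdd_neg, ← ofAdd_add, nsmul_sub, neg_add_eq_sub]
  · rw [map_list_prod, List.map_map]
    have h := List.prod_range_div n fun i : ℕ =>
      Multiplicative.ofAdd (m • generatorClass n k m ((2 * i + 1 : ℕ) : ZMod (2 * n)))
    have hperiod : generatorClass n k m ((2 * n + 1 : ℕ) : ZMod (2 * n)) =
        generatorClass n k m ((2 * 0 + 1 : ℕ) : ZMod (2 * n)) := by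
      rw [Nat.cast_add, ZMod.natCast_self, mul_zero, Nat.cast_add, Nat.cast_zero]
    rw [hperiod, div_self'] at h
    rw [← h]
    congr 1
    refine List.map_congr_left fun i _ => ?_
    rw [Function.comp_apply, FreeGroup.lift_apply_of, hrel, nsmul_sub, ofAdd_sub]

end Laplacian

theorem isFibSequence_presentedGroup (n k m : ℕ) (hn : 0 < n) :
    IsFibSequence n (fun j => if j % 2 = 0 then k else m)
      (fun j => PresentedGroup.of (rels := deformedFibRels n k m) (j : ZMod (2 * n))) := by
  have hper : Function.Periodic
      (fun j : ℕ => PresentedGroup.of (rels := deformedFibRels n k m) (j : ZMod (2 * n)))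
      (2 * n) := fun j => by simp
  refine ⟨hper, fun j => ?_, ?_⟩
  · have hmod : ∀ i c : ℕ, ((2 * i + c : ℕ) : ZMod (2 * n)) = (2 * (i % n) + c : ℕ) := by
      intro i c
      rw [ZMod.natCast_eq_natCast_iff, ← Nat.mul_mod_mul_left]
      exact (Nat.mod_modEq _ _).symm.add_right c
    obtain ⟨i, rfl | rfl⟩ := Nat.even_or_odd' j
    · have hlt := Nat.mod_lt i hn
      have := PresentedGroup.one_of_mem (rels := deformedFibRels n k m)
        (Or.inl (Or.inl ⟨i % n, hlt, rfl⟩))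
      rw [← hmod i 1, ← hmod i 2, ← Nat.add_zero (2 * (i % n)), ← hmod i 0, map_mul, map_inv,
        mul_inv_eq_one, map_mul, map_inv, inv_mul_eq_iff_eq_mul, map_pow, map_pow] at this
      simp only [show 2 * i % 2 = 0 by omega, if_true]
      exact this.symm
    · have hlt := Nat.mod_lt i hn
      have := PresentedGroup.one_of_mem (rels := deformedFibRels n k m)
        (Or.inl (Or.inr ⟨i % n, hlt, rfl⟩))
      rw [← hmod i 1, ← hmod i 2, ← hmod i 3, map_mul, map_inv,
        mul_inv_eq_one, map_mul, map_inv, inv_mul_eq_iff_eq_mul, map_pow, map_pow] at this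
      simp only [show (2 * i + 1) % 2 = 1 by omega, one_ne_zero, if_false]
      exact this.symm
  · have := PresentedGroup.one_of_mem (rels := deformedFibRels n k m) (Or.inr rfl)
    rwa [map_list_prod, List.map_map] at this

/-- For `n ≥ 2` and positive `k, m`, the group
`⟨z₁,…,z_{2n} | z_{2i+1} = z_{2i}^{−k} z_{2i+2}^{k}, z_{2i} = z_{2i−1}^{−m} z_{2i+1}^{m},
z₂z₄⋯z_{2n} = e⟩` is not left-orderable. -/
theorem stmt_10 (n k m : ℕ) (hn : 2 ≤ n) (hk : 0 < k) (hm : 0 < m) :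
    ¬ IsLeftOrderable (PresentedGroup (deformedFibRels n k m)) := by
  intro h
  obtain ⟨P, hP⟩ := h.exists_isTotalCone
  have hone := (isFibSequence_presentedGroup n k m (by omega)).eq_one hP (by omega)
    (fun j => by split_ifs <;> assumption) (2 * 0)
  have hmap := congrArg (PresentedGroup.toGroup (rels := deformedFibRels n k m)
    fun w hw => lift_generatorClass_eq_one n k m hw) hone
  rw [PresentedGroup.toGroup.of, map_one, ofAdd_eq_one, generatorClass_even, Nat.cast_zero] at hmap
  exact vertexClass_zero_ne_zero hn hk hm hmap
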